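/- Let $p_0$ be a distribution on a finite set $S$ of size at least 2, $\pi = \delta_M$ for a mask state $M \in S$ with $p_0(M)=0$, and $0 < \alpha_t < 1$. Let $P$ be the posterior kernel $P(x_0\mid x_t) = f_t(x_t)\delta_{x_t}(x_0) + (1-f_t(x_t))p_0(x_0)$ with $f_t(x_t) = \frac{\alpha_t p_0(x_t)}{\alpha_t p_0(x_t)+(1-\alpha_t)\pi(x_t)}$. Then $f_t(x) = 1$ for all non-mask states $x$ with $p_0(x)>0$, and for any two distinct non-mask states $j,k$ with $p_0(j), p_0(k) > 0$, swapping the masses of $j$ and $k$ in an input distribution yields $TV(P\hat{q}, Pq) = TV(\hat{q}, q)$; hence $\eta_{TV}(P) = 1$. -/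

import Mathlib

open Finset

/-- Total variation distance between two distributions on a finite type. -/
noncomputable def tvDist {α : Type*} [Fintype α] (q p : α → ℝ) : ℝ :=
  (∑ x, |q x - p x|) / 2

/-- Two probability vectors on a finite type are at total variation distance at most `1`. -/
theorem tvDist_le_one {α : Type*} [Fintype α] {q p : α → ℝ} (hq : ∀ x, 0 ≤ q x)
    (hp : ∀ x, 0 ≤ p x) (hqsum : ∑ x, q x = 1) (hpsum : ∑ x, p x = 1) : tvDist q p ≤ 1 := by
  have h : ∑ x, |q x - p x| ≤ ∑ x, (q x + p x) :=
    Finset.sum_le_sum fun x _ => abs_le.2 ⟨by linarith [hq x], by linarith [hp x]⟩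
  rw [Finset.sum_add_distrib, hqsum, hpsum] at h
  unfold tvDist
  linarith

/-- Distinct point masses are at total variation distance `1`. -/
theorem tvDist_pointMass {α : Type*} [Fintype α] [DecidableEq α] {j k : α} (hjk : j ≠ k) :
    tvDist (fun x => if x = j then (1 : ℝ) else 0) (fun x => if x = k then (1 : ℝ) else 0) = 1 := by
  have h : ∀ x, |(if x = j then (1 : ℝ) else 0) - (if x = k then (1 : ℝ) else 0)|
      = (if x = j then (1 : ℝ) else 0) + (if x = k then (1 : ℝ) else 0) := by
    intro x
    by_cases hj : x = j
    · subst hj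
      simp [hjk]
    · by_cases hk : x = k <;> simp [hj, hk, hjk.symm]
  simp only [tvDist, h, Finset.sum_add_distrib, Finset.sum_ite_eq', Finset.mem_univ, if_true]
  norm_num

/-- Masking diffusion fails to contract: with `π = δ_M` and `p₀(M) = 0`, the posterior copies
every non-mask state (`f(x) = 1` when `p₀(x) > 0` and `x ≠ M`), swapping the masses of two
non-mask states is preserved exactly in total variation, and the Dobrushin coefficient is `1`. -/
theorem masking_posterior_no_contraction
    {S : Type*} [Fintype S] [DecidableEq S]
    (M : S) (p0 : S → ℝ) (hp0 : ∀ x, 0 ≤ p0 x) (hp0sum : ∑ x, p0 x = 1) (hp0M : p0 M = 0)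
    (αt : ℝ) (hαt0 : 0 < αt) (hαt1 : αt < 1)
    (f : S → ℝ)
    (hf : ∀ x, f x = αt * p0 x / (αt * p0 x + (1 - αt) * (if x = M then (1 : ℝ) else 0)))
    (P : S → S → ℝ)
    (hP : ∀ x0 xt, P x0 xt = f xt * (if x0 = xt then (1 : ℝ) else 0) + (1 - f xt) * p0 x0)
    (j k : S) (hjk : j ≠ k) (hjM : j ≠ M) (hkM : k ≠ M)
    (hpj : 0 < p0 j) (hpk : 0 < p0 k) :
    (∀ x, x ≠ M → 0 < p0 x → f x = 1) ∧
    (∀ q : S → ℝ, (∀ x, 0 ≤ q x) → ∑ x, q x = 1 →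
      tvDist (fun x0 => ∑ xt, P x0 xt *
          (if xt = j then q k else if xt = k then q j else q xt))
        (fun x0 => ∑ xt, P x0 xt * q xt)
      = tvDist (fun x => if x = j then q k else if x = k then q j else q x) q) ∧
    (Finset.univ.offDiag.sup' ⟨(j, k), by simp [Finset.mem_offDiag, hjk]⟩
      (fun xx => tvDist (fun x0 => P x0 xx.1) (fun x0 => P x0 xx.2)) = 1) := by
  have hf1 : ∀ x, x ≠ M → 0 < p0 x → f x = 1 := by
    intro x hx hpx
    rw [hf, if_neg hx, mul_zero, add_zero]
    exact div_self (mul_pos hαt0 hpx).ne'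
  have hf_mem : ∀ x, 0 ≤ f x ∧ f x ≤ 1 := by
    intro x
    have ha : 0 ≤ αt * p0 x := mul_nonneg hαt0.le (hp0 x)
    have hb : 0 ≤ (1 - αt) * (if x = M then (1 : ℝ) else 0) :=
      mul_nonneg (by linarith) (by split_ifs <;> norm_num)
    rw [hf]
    exact ⟨div_nonneg ha (add_nonneg ha hb),
      div_le_one_of_le₀ (by linarith) (add_nonneg ha hb)⟩
  have hP_id : ∀ x, x ≠ M → 0 < p0 x → ∀ x0, P x0 x = if x0 = x then (1 : ℝ) else 0 := by
    intro x hx hpx x0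
    rw [hP, hf1 x hx hpx]
    ring
  have hP_nonneg : ∀ x x0, 0 ≤ P x0 x := by
    intro x x0
    rw [hP]
    exact add_nonneg (mul_nonneg (hf_mem x).1 (by split_ifs <;> norm_num))
      (mul_nonneg (by linarith [(hf_mem x).2]) (hp0 x0))
  have hP_sum : ∀ x, ∑ x0, P x0 x = 1 := by
    intro x
    simp only [hP, Finset.sum_add_distrib, ← Finset.mul_sum, hp0sum, Finset.sum_ite_eq',
      Finset.mem_univ, if_true]
    ring
  refine ⟨hf1, fun q _ _ => ?_, le_antisymm ?_ ?_⟩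
  · set r : S → ℝ := fun x => if x = j then q k else if x = k then q j else q x with hr
    have hterm : ∀ x0 xt, P x0 xt * r xt - P x0 xt * q xt
        = if x0 = xt then r xt - q xt else 0 := by
      intro x0 xt
      by_cases hj : xt = j
      · rw [hj, hP_id j hjM hpj]
        split_ifs <;> ring
      by_cases hk : xt = k
      · rw [hk, hP_id k hkM hpk]
        split_ifs <;> ring
      simp [hr, hj, hk]
    have hdiff : ∀ x0, ∑ xt, P x0 xt * r xt - ∑ xt, P x0 xt * q xt = r x0 - q x0 := by
      intro x0
      rw [← Finset.sum_sub_distrib, Finset.sum_congr rfl fun xt _ => hterm x0 xt]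
      simp
    change (∑ x0, |∑ xt, P x0 xt * r xt - ∑ xt, P x0 xt * q xt|) / 2
      = (∑ x0, |r x0 - q x0|) / 2
    simp only [hdiff]
  · exact Finset.sup'_le _ _ fun xx _ =>
      tvDist_le_one (hP_nonneg _) (hP_nonneg _) (hP_sum _) (hP_sum _)
  · refine le_trans (le_of_eq ?_) (Finset.le_sup' _ (b := (j, k)) (by simp [hjk]))
    simp only [hP_id j hjM hpj, hP_id k hkM hpk]
    exact (tvDist_pointMass hjk).symm
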